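/- Let T ∈ ℕ and run the dynamics with constant parameters γ_τ = γ > 0, η_τ = η ≥ 0, β_τ = 2, ζ_τ = γ for all τ ∈ {0,…,T−1}, with Λ_0 = 0, Y_0 = 0, and assume the trackability condition η² − η/4 + γ²C₁²/(4K) ≤ 0. Assume v is monotone on 𝒳, let (x*, λ*) ∈ 𝒳 × ℝ^R_{≥0} solve VI(𝒳 × ℝ^R_{≥0}, ṽ) with ṽ(x,λ) = (v(x) − Aᵀλ, Ax − b), and assume the noise is persistent with power σ_* ≥ 0, i.e. E[‖ξ_τ‖_*²] ≤ σ_*² for all τ. Then, with C̃₁ = 2(C₂²/K + 2C₃²), the average norm of the clipped cumulative constraint violation satisfies (1/T) E[ ‖[Σ_{τ=0}^{T−1}(A X_τ − b)]₊‖₂ ] ≤ sqrt( (2(ηT+1)/(γT²))(Δψ/γ + C̃₁ γ T) + ((ηT+1)²/(γ²T²)) ‖λ*‖₂² + ((ηT+1)²/T²)(4σ_*²T/K) ). -/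

import Mathlib

open scoped Matrix
open Finset MeasureTheory

/-- The standard inner product on the product space ∏ᵢ ℝ^{Dᵢ}. -/
def gInner {N : ℕ} {Dd : Fin N → ℕ} (x y : (i : Fin N) → Fin (Dd i) → ℝ) : ℝ :=
  ∑ i, x i ⬝ᵥ y i

/-- The dual norm ‖y‖_* = sup{⟨y,x⟩ : ‖x‖ ≤ 1} of a norm `nrm` on ℝ^n. -/
noncomputable def dualN {n : ℕ} (nrm : (Fin n → ℝ) → ℝ) (y : Fin n → ℝ) : ℝ :=
  sSup {r : ℝ | ∃ x : Fin n → ℝ, nrm x ≤ 1 ∧ r = y ⬝ᵥ x}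

/-- The dual norm ‖y‖_* = (Σᵢ ‖y⁽ⁱ⁾‖_{i,*}²)^{1/2} on the product space ∏ᵢ ℝ^{Dᵢ}. -/
noncomputable def gDualN {N : ℕ} {Dd : Fin N → ℕ} (nrm : ∀ i, (Fin (Dd i) → ℝ) → ℝ)
    (y : (i : Fin N) → Fin (Dd i) → ℝ) : ℝ :=
  Real.sqrt (∑ i, dualN (nrm i) (y i) ^ 2)

/-- Generalized Cauchy–Schwarz inequality for a norm and its dual norm. -/
theorem dotProduct_le_dualN_mul {n : ℕ} {nrm : (Fin n → ℝ) → ℝ}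
    (h0 : ∀ x, nrm x = 0 ↔ x = 0) (hS : ∀ (c : ℝ) x, nrm (c • x) = |c| * nrm x)
    (hT : ∀ x y, nrm (x + y) ≤ nrm x + nrm y) (y x : Fin n → ℝ) :
    y ⬝ᵥ x ≤ dualN nrm y * nrm x := by
  have hnn : ∀ x, 0 ≤ nrm x := fun x => by
    have h := hT x ((-1 : ℝ) • x)
    rw [hS, (h0 (x + (-1 : ℝ) • x)).2 (by simp)] at h
    norm_num at h
    linarith
  let p : Seminorm ℝ (Fin n → ℝ) := Seminorm.of nrm hT (fun c x => by simpa using hS c x)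
  have hp : ∀ x, p x = nrm x := fun _ => rfl
  have hcont : Continuous nrm := by
    have hle : ∀ x, nrm x ≤ (∑ j, nrm (Pi.single j 1)) * ‖x‖ := fun x => by
      have hx : x = ∑ j, x j • (Pi.single j (1 : ℝ) : Fin n → ℝ) := by
        ext k
        simp [Finset.sum_apply, Pi.single_apply]
      calc nrm x = p (∑ j, x j • (Pi.single j (1 : ℝ) : Fin n → ℝ)) := by rw [hp, ← hx]
        _ ≤ ∑ j, p (x j • (Pi.single j (1 : ℝ) : Fin n → ℝ)) :=
            Finset.le_sum_of_subadditive p (map_zero p).le (map_add_le_add p) _ _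
        _ = ∑ j, |x j| * nrm (Pi.single j 1) := by simp [hp, hS]
        _ ≤ ∑ j, ‖x‖ * nrm (Pi.single j 1) := by
            gcongr with j
            · exact hnn _
            · simpa using norm_le_pi_norm x j
        _ = _ := by rw [Finset.sum_mul]; simp [mul_comm]
    have : Continuous p := by
      refine Seminorm.continuous_of_continuousAt_zero ?_
      rw [ContinuousAt, map_zero]
      refine squeeze_zero hnn hle ?_
      have h : Continuous fun x : Fin n → ℝ => (∑ j, nrm (Pi.single j 1)) * ‖x‖ := by fun_prop
      simpa using h.tendsto 0
    exact this
  obtain ⟨c, hc, hcle⟩ : ∃ c > 0, ∀ x, c * ‖x‖ ≤ nrm x := by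
    rcases (Metric.sphere (0 : Fin n → ℝ) 1).eq_empty_or_nonempty with he | hne
    · refine ⟨1, one_pos, fun x => ?_⟩
      by_cases hx : x = 0
      · simp [hx, (h0 0).2 rfl]
      · have : (‖x‖⁻¹ • x) ∈ Metric.sphere (0 : Fin n → ℝ) 1 := by
          simp [norm_smul, hx]
        simp [he] at this
    · obtain ⟨z, hz, hmin⟩ := (isCompact_sphere (0 : Fin n → ℝ) 1).exists_isMinOn hne
        hcont.continuousOn
      have hz0 : z ≠ 0 := by
        rintro rfl
        simp at hz
      refine ⟨nrm z, lt_of_le_of_ne (hnn z) fun h => hz0 ((h0 z).1 h.symm), fun x => ?_⟩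
      by_cases hx : x = 0
      · simp [hx, (h0 0).2 rfl]
      · have hpos : 0 < ‖x‖ := norm_pos_iff.2 hx
        have h := hmin (show (‖x‖⁻¹ • x) ∈ Metric.sphere (0 : Fin n → ℝ) 1 by
          simp [norm_smul, hx])
        simp only [Set.mem_ofPred_eq, hS, abs_inv, abs_norm] at h
        rwa [← div_eq_inv_mul, le_div_iff₀ hpos] at h
  have hbdd : BddAbove {r : ℝ | ∃ x : Fin n → ℝ, nrm x ≤ 1 ∧ r = y ⬝ᵥ x} := by
    refine ⟨∑ j, |y j| * c⁻¹, ?_⟩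
    rintro r ⟨x, hx, rfl⟩
    refine Finset.sum_le_sum fun j _ => ?_
    have h1 : ‖x‖ ≤ c⁻¹ := by
      rw [← one_div, le_div_iff₀ hc, mul_comm]
      exact (hcle x).trans hx
    have h2 : |x j| ≤ ‖x‖ := by simpa using norm_le_pi_norm x j
    calc y j * x j ≤ |y j * x j| := le_abs_self _
      _ = |y j| * |x j| := abs_mul _ _
      _ ≤ |y j| * c⁻¹ := by gcongr; exact h2.trans h1
  by_cases hx : x = 0
  · simp [hx, (h0 0).2 rfl]
  · have hpos : 0 < nrm x := lt_of_le_of_ne (hnn x) fun h => hx ((h0 x).1 h.symm)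
    have h := le_csSup hbdd ⟨(nrm x)⁻¹ • x, by
      rw [hS, abs_inv, abs_of_pos hpos, inv_mul_cancel₀ hpos.ne'], rfl⟩
    rw [dotProduct_smul, smul_eq_mul, inv_mul_le_iff₀ hpos] at h
    rw [mul_comm]
    exact h

/-- A maximizer of a strongly concave objective has quadratic growth. -/
theorem strongConvex_max_quadratic_growth {n : ℕ} {s : Set (Fin n → ℝ)} (hs : Convex ℝ s)
    {nrm ψ : (Fin n → ℝ) → ℝ} {k : ℝ}
    (hψ : ∀ x ∈ s, ∀ y ∈ s, ∀ t ∈ Set.Icc (0 : ℝ) 1,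
      ψ (t • x + (1 - t) • y) ≤ t * ψ x + (1 - t) * ψ y - k / 2 * t * (1 - t) * nrm (x - y) ^ 2)
    {y x z : Fin n → ℝ} (hx : x ∈ s) (hz : z ∈ s)
    (hmax : IsMaxOn (fun x => y ⬝ᵥ x - ψ x) s z) :
    y ⬝ᵥ x - ψ x + k / 2 * nrm (x - z) ^ 2 ≤ y ⬝ᵥ z - ψ z := by
  have key : ∀ t ∈ Set.Ioo (0 : ℝ) 1,
      y ⬝ᵥ x - ψ x + k / 2 * (1 - t) * nrm (x - z) ^ 2 ≤ y ⬝ᵥ z - ψ z := by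
    rintro t ⟨ht0, ht1⟩
    have h1 := hψ x hx z hz t ⟨ht0.le, ht1.le⟩
    have h2 := hmax (hs hx hz ht0.le (sub_nonneg.2 ht1.le) (by ring) :
      t • x + (1 - t) • z ∈ s)
    simp only [Set.mem_ofPred_eq, dotProduct_add, dotProduct_smul, smul_eq_mul] at h2
    have h3 : t * (y ⬝ᵥ x - ψ x + k / 2 * (1 - t) * nrm (x - z) ^ 2)
        ≤ t * (y ⬝ᵥ z - ψ z) := by nlinarith
    exact le_of_mul_le_mul_left h3 ht0
  have hlim : Filter.Tendsto
      (fun t : ℝ => y ⬝ᵥ x - ψ x + k / 2 * (1 - t) * nrm (x - z) ^ 2) (nhdsWithin 0 (Set.Ioi 0))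
      (nhds (y ⬝ᵥ x - ψ x + k / 2 * (1 - 0) * nrm (x - z) ^ 2)) :=
    (Continuous.tendsto (by fun_prop) 0).mono_left nhdsWithin_le_nhds
  have h := le_of_tendsto hlim
    (Filter.eventually_of_mem (Ioo_mem_nhdsGT one_pos) key)
  simpa using h

/-- The sum over the agents of the convex conjugates of the regularizers, evaluated through
the mirror maps. -/
def conjugateSum {N : ℕ} {Dd : Fin N → ℕ} (ψ : ∀ i, (Fin (Dd i) → ℝ) → ℝ)
    (Φ : ∀ i, (Fin (Dd i) → ℝ) → (Fin (Dd i) → ℝ)) (y : (i : Fin N) → Fin (Dd i) → ℝ) : ℝ :=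
  ∑ i, (y i ⬝ᵥ Φ i (y i) - ψ i (Φ i (y i)))

section gInner

variable {N : ℕ} {Dd : Fin N → ℕ} (x y z : (i : Fin N) → Fin (Dd i) → ℝ)

theorem gInner_add_right : gInner x (y + z) = gInner x y + gInner x z := by
  simp [gInner, dotProduct_add, Finset.sum_add_distrib]

theorem gInner_sub_right : gInner x (y - z) = gInner x y - gInner x z := by
  simp [gInner, dotProduct_sub, Finset.sum_sub_distrib]

theorem gInner_sub_left : gInner (x - y) z = gInner x z - gInner y z := by
  simp [gInner, sub_dotProduct, Finset.sum_sub_distrib]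

theorem gInner_smul_right (c : ℝ) : gInner x (c • y) = c * gInner x y := by
  simp [gInner, dotProduct_smul, Finset.mul_sum]

end gInner

section MirrorMap

variable {N : ℕ} {Dd : Fin N → ℕ} {Xset : ∀ i, Set (Fin (Dd i) → ℝ)}
  {ψ : ∀ i, (Fin (Dd i) → ℝ) → ℝ} {Φ : ∀ i, (Fin (Dd i) → ℝ) → (Fin (Dd i) → ℝ)}

theorem gInner_sub_le_conjugateSum
    (hΦmax : ∀ i y, IsMaxOn (fun x => y ⬝ᵥ x - ψ i x) (Xset i) (Φ i y))
    {x : (i : Fin N) → Fin (Dd i) → ℝ} (hx : ∀ i, x i ∈ Xset i)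
    (y : (i : Fin N) → Fin (Dd i) → ℝ) :
    gInner x y - ∑ i, ψ i (x i) ≤ conjugateSum ψ Φ y := by
  rw [gInner, conjugateSum, ← Finset.sum_sub_distrib]
  refine Finset.sum_le_sum fun i _ => ?_
  rw [dotProduct_comm]
  exact hΦmax i (y i) (hx i)

/-- Subgradient inequality for the conjugate, based at the new point. -/
theorem conjugateSum_add_le
    (hΦmem : ∀ i y, Φ i y ∈ Xset i)
    (hΦmax : ∀ i y, IsMaxOn (fun x => y ⬝ᵥ x - ψ i x) (Xset i) (Φ i y))
    (y w : (i : Fin N) → Fin (Dd i) → ℝ) :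
    conjugateSum ψ Φ (y + w) ≤ conjugateSum ψ Φ y + gInner (fun i => Φ i ((y + w) i)) w := by
  have h := gInner_sub_le_conjugateSum hΦmax (x := fun i => Φ i ((y + w) i))
    (fun i => hΦmem i _) y
  have h2 : conjugateSum ψ Φ (y + w) = gInner (fun i => Φ i ((y + w) i)) (y + w)
      - ∑ i, ψ i (Φ i ((y + w) i)) := by
    simp only [conjugateSum, gInner, ← Finset.sum_sub_distrib]
    refine Finset.sum_congr rfl fun i _ => ?_
    rw [dotProduct_comm]
  rw [h2, gInner_add_right]
  linarith

/-- Smoothness of the conjugate along a step split into two directions. -/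
theorem conjugateSum_smooth
    (hXconv : ∀ i, Convex ℝ (Xset i))
    {nrm : ∀ i, (Fin (Dd i) → ℝ) → ℝ}
    (hnrm0 : ∀ i x, nrm i x = 0 ↔ x = 0)
    (hnrmS : ∀ i (c : ℝ) x, nrm i (c • x) = |c| * nrm i x)
    (hnrmT : ∀ i x y, nrm i (x + y) ≤ nrm i x + nrm i y)
    {Ks : Fin N → ℝ} {K : ℝ} (hKpos : 0 < K) (hK : ∀ i, K ≤ Ks i)
    (hψsc : ∀ i, ∀ x ∈ Xset i, ∀ y ∈ Xset i, ∀ s ∈ Set.Icc (0 : ℝ) 1,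
      ψ i (s • x + (1 - s) • y) ≤ s * ψ i x + (1 - s) * ψ i y
        - Ks i / 2 * s * (1 - s) * nrm i (x - y) ^ 2)
    (hΦmem : ∀ i y, Φ i y ∈ Xset i)
    (hΦmax : ∀ i y, IsMaxOn (fun x => y ⬝ᵥ x - ψ i x) (Xset i) (Φ i y))
    {c : ℝ} (hc : 0 ≤ c) (y u w : (i : Fin N) → Fin (Dd i) → ℝ) :
    conjugateSum ψ Φ (y + c • (u + w)) ≤ conjugateSum ψ Φ y
      + c * gInner (fun i => Φ i (y i)) (u + w)
      + c ^ 2 / K * (gDualN nrm u ^ 2 + gDualN nrm w ^ 2) := by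
  have hsq : ∀ u : (i : Fin N) → Fin (Dd i) → ℝ,
      gDualN nrm u ^ 2 = ∑ i, dualN (nrm i) (u i) ^ 2 := fun u =>
    Real.sq_sqrt (Finset.sum_nonneg fun _ _ => sq_nonneg _)
  rw [hsq, hsq, ← Finset.sum_add_distrib, Finset.mul_sum, gInner, Finset.mul_sum, conjugateSum,
    conjugateSum, ← Finset.sum_add_distrib, ← Finset.sum_add_distrib]
  refine Finset.sum_le_sum fun i _ => ?_
  have hp : (y + c • (u + w)) i = y i + c • (u i + w i) := rfl
  rw [hp]
  generalize hx' : Φ i (y i + c • (u i + w i)) = x'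
  have hx'mem : x' ∈ Xset i := hx' ▸ hΦmem i _
  have hgrow := strongConvex_max_quadratic_growth (hXconv i) (hψsc i) hx'mem (hΦmem i (y i))
    (hΦmax i (y i))
  have hu := dotProduct_le_dualN_mul (hnrm0 i) (hnrmS i) (hnrmT i) (u i) (x' - Φ i (y i))
  have hw := dotProduct_le_dualN_mul (hnrm0 i) (hnrmS i) (hnrmT i) (w i) (x' - Φ i (y i))
  have hyoung : ∀ a d : ℝ, c * (a * d) ≤ c ^ 2 / K * a ^ 2 + K / 4 * d ^ 2 := fun a d => by
    have h : c ^ 2 / K * a ^ 2 + K / 4 * d ^ 2 - c * (a * d) = (c * a - K / 2 * d) ^ 2 / K := by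
      field_simp
      ring
    have : 0 ≤ (c * a - K / 2 * d) ^ 2 / K := by positivity
    linarith
  have hu2 := (mul_le_mul_of_nonneg_left hu hc).trans (hyoung _ _)
  have hw2 := (mul_le_mul_of_nonneg_left hw hc).trans (hyoung _ _)
  have hKi := mul_le_mul_of_nonneg_right (hK i) (sq_nonneg (nrm i (x' - Φ i (y i))))
  simp only [Pi.add_apply, add_dotProduct, smul_dotProduct, dotProduct_add, dotProduct_sub,
    smul_eq_mul] at *
  rw [dotProduct_comm (Φ i (y i)) (u i), dotProduct_comm (Φ i (y i)) (w i)]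
  linarith

end MirrorMap

/-- One step of the price recursion, in a single coordinate: `l`, `max (l + q) 0` are consecutive
prices, and the cross term pairs the new violation `g'` with the old price `l`. -/
theorem price_step {γ η l g g' : ℝ} (hη : 0 ≤ η) (hη' : η ≤ 1 / 6) (hl : 0 ≤ l) :
    max (max (l + (γ * g - η * l)) 0 + (γ * g' - η * max (l + (γ * g - η * l)) 0)) 0 ^ 2
        + η * max (l + (γ * g - η * l)) 0 ^ 2
        + (γ * g' - η * max (l + (γ * g - η * l)) 0) ^ 2
      ≤ max (l + (γ * g - η * l)) 0 ^ 2 + 2 * γ * (g' * l) + (γ * g - η * l) ^ 2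
        + 4 * γ ^ 2 * g' ^ 2 := by
  have hmaxsq : ∀ a : ℝ, max a 0 ^ 2 ≤ a ^ 2 := fun a => by
    rcases max_cases a 0 with ⟨h, _⟩ | ⟨h, _⟩ <;> rw [h]
    simpa using sq_nonneg a
  have hdiff : (max (l + (γ * g - η * l)) 0 - l) ^ 2 ≤ (γ * g - η * l) ^ 2 := by
    rcases max_cases (l + (γ * g - η * l)) 0 with ⟨h, _⟩ | ⟨h, _⟩ <;> rw [h] <;> nlinarith
  generalize max (l + (γ * g - η * l)) 0 = l' at *
  have h1 := hmaxsq (l' + (γ * g' - η * l'))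
  have h2 : 2 * (γ * g' * (l' - l)) ≤ (γ * g') ^ 2 + (l' - l) ^ 2 := by
    nlinarith [sq_nonneg (γ * g' - (l' - l))]
  have h3 : 2 * (γ * g' - η * l') ^ 2 ≤ 3 * (γ * g') ^ 2 + 6 * (η * l') ^ 2 := by
    nlinarith [sq_nonneg (γ * g' + 2 * (η * l'))]
  have h4 : 6 * (η * l') ^ 2 ≤ η * l' ^ 2 := by
    have : 6 * η ^ 2 * l' ^ 2 ≤ η * l' ^ 2 :=
      mul_le_mul_of_nonneg_right (by nlinarith) (sq_nonneg _)
    nlinarith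
  nlinarith

theorem dotProduct_self_eq_sum_sq {R : ℕ} (x : Fin R → ℝ) : x ⬝ᵥ x = ∑ r, x r ^ 2 := by
  simp [dotProduct, sq]

/-- Energy estimate for the price recursion coupled with a primal potential `H`. -/
theorem price_energy_le {R T : ℕ} {γ η H₀ : ℝ} {H e : ℕ → ℝ} {l g : ℕ → Fin R → ℝ}
    (hη : 0 ≤ η) (hη' : η ≤ 1 / 6) (hl0 : ∀ r, l 0 r = 0)
    (hl : ∀ n < T, ∀ r, l (n + 1) r = max (l n r + (γ * g n r - η * l n r)) 0)
    (hH0 : H 0 ≤ H₀ + e 0)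
    (hH : ∀ n, n + 1 < T → H (n + 1) ≤ H n - 2 * γ * (g (n + 1) ⬝ᵥ l n) + e (n + 1))
    (n : ℕ) (hn : n < T) :
    l (n + 1) ⬝ᵥ l (n + 1) + η * ∑ s ∈ range (n + 1), l s ⬝ᵥ l s + H n
        + ∑ r, (γ * g n r - η * l n r) ^ 2
      ≤ H₀ + ∑ s ∈ range (n + 1), (e s + 4 * γ ^ 2 * (g s ⬝ᵥ g s)) := by
  induction n with
  | zero =>
    have h : l 1 ⬝ᵥ l 1 + ∑ r, (γ * g 0 r - η * l 0 r) ^ 2 ≤ 4 * γ ^ 2 * (g 0 ⬝ᵥ g 0) := by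
      rw [dotProduct_self_eq_sum_sq, dotProduct_self_eq_sum_sq, ← Finset.sum_add_distrib,
        Finset.mul_sum]
      refine Finset.sum_le_sum fun r _ => ?_
      rw [hl 0 hn r, hl0]
      rcases max_cases (0 + (γ * g 0 r - η * 0)) 0 with ⟨h, _⟩ | ⟨h, _⟩ <;> rw [h] <;>
        nlinarith [sq_nonneg (γ * g 0 r)]
    have h0 : l 0 ⬝ᵥ l 0 = 0 := by simp [dotProduct, hl0]
    simp only [zero_add, Finset.sum_range_one, h0]
    linarith
  | succ n ih =>
    have ih := ih (by omega)
    have hnn : ∀ r, 0 ≤ l n r := fun r => by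
      cases n with
      | zero => exact (hl0 r).ge
      | succ m => rw [hl m (by omega)]; exact le_max_right _ _
    have hstep : l (n + 2) ⬝ᵥ l (n + 2) + η * (l (n + 1) ⬝ᵥ l (n + 1))
          + ∑ r, (γ * g (n + 1) r - η * l (n + 1) r) ^ 2
        ≤ l (n + 1) ⬝ᵥ l (n + 1) + 2 * γ * (g (n + 1) ⬝ᵥ l n)
          + ∑ r, (γ * g n r - η * l n r) ^ 2 + 4 * γ ^ 2 * (g (n + 1) ⬝ᵥ g (n + 1)) := by
      rw [dotProduct_self_eq_sum_sq, dotProduct_self_eq_sum_sq, dotProduct_self_eq_sum_sq,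
        dotProduct, Finset.mul_sum, Finset.mul_sum, Finset.mul_sum, ← Finset.sum_add_distrib,
        ← Finset.sum_add_distrib, ← Finset.sum_add_distrib, ← Finset.sum_add_distrib,
        ← Finset.sum_add_distrib]
      refine Finset.sum_le_sum fun r _ => ?_
      rw [hl (n + 1) hn r, hl n (by omega) r]
      exact price_step hη hη' (hnn r)
    have hHn := hH n hn
    rw [Finset.sum_range_succ _ (n + 1), Finset.sum_range_succ _ (n + 1), mul_add]
    linarith

theorem sq_add_mul_sum_le {T : ℕ} {η a : ℝ} (hη : 0 ≤ η) (l : ℕ → ℝ) :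
    (a + η * ∑ s ∈ range T, l s) ^ 2
      ≤ (η * T + 1) * (a ^ 2 + η * ∑ s ∈ range T, l s ^ 2) := by
  have h1 := sq_sum_le_card_mul_sum_sq (s := range T) (f := l)
  rw [Finset.card_range] at h1
  have h2 : 2 * a * ∑ s ∈ range T, l s ≤ T * a ^ 2 + ∑ s ∈ range T, l s ^ 2 := by
    have : ∑ s ∈ range T, 2 * a * l s ≤ ∑ s ∈ range T, (a ^ 2 + l s ^ 2) :=
      Finset.sum_le_sum fun s _ => by nlinarith [sq_nonneg (a - l s)]
    rw [← Finset.mul_sum, Finset.sum_add_distrib] at this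
    simpa using this
  have h3 := mul_le_mul_of_nonneg_left h1 (sq_nonneg η)
  have h4 := mul_le_mul_of_nonneg_left h2 hη
  nlinarith

/-- The clipped cumulative violation is controlled by the energy of the prices. -/
theorem clipped_violation_sq_le {R T : ℕ} {γ η : ℝ} {l g : ℕ → Fin R → ℝ} (hγ : 0 ≤ γ)
    (hη : 0 ≤ η) (hl0 : ∀ r, l 0 r = 0)
    (hl : ∀ n < T, ∀ r, l (n + 1) r = max (l n r + (γ * g n r - η * l n r)) 0) :
    γ ^ 2 * ∑ r, max ((∑ s ∈ range T, g s) r) 0 ^ 2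
      ≤ (η * T + 1) * (l T ⬝ᵥ l T + η * ∑ s ∈ range T, l s ⬝ᵥ l s) := by
  have hnn : ∀ n ≤ T, ∀ r, 0 ≤ l n r := fun n hn r => by
    cases n with
    | zero => exact (hl0 r).ge
    | succ m => rw [hl m (by omega)]; exact le_max_right _ _
  have hlin : ∀ r, ∀ n ≤ T,
      γ * ∑ s ∈ range n, g s r ≤ l n r + η * ∑ s ∈ range n, l s r := fun r n => by
    induction n with
    | zero => simp [hl0]
    | succ n ih =>
      intro hn
      have := ih (by omega)
      have h := le_max_left (l n r + (γ * g n r - η * l n r)) 0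
      rw [← hl n hn r] at h
      rw [Finset.sum_range_succ, Finset.sum_range_succ, mul_add, mul_add]
      linarith
  simp_rw [dotProduct_self_eq_sum_sq]
  rw [Finset.sum_comm, Finset.mul_sum _ _ η, ← Finset.sum_add_distrib, Finset.mul_sum, Finset.mul_sum]
  refine Finset.sum_le_sum fun r _ => ?_
  refine le_trans ?_ (sq_add_mul_sum_le hη fun s => l s r)
  rw [← mul_pow]
  have hm : 0 ≤ l T r + η * ∑ s ∈ range T, l s r :=
    add_nonneg (hnn T le_rfl r) (mul_nonneg hη
      (Finset.sum_nonneg fun s hs => hnn s (Finset.mem_range.1 hs).le r))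
  refine pow_le_pow_left₀ (mul_nonneg hγ (le_max_right _ _)) ?_ 2
  rw [mul_max_of_nonneg _ _ hγ, mul_zero, Finset.sum_apply]
  exact max_le (hlin r T le_rfl) hm

/-- Cauchy–Schwarz over time: the clipped sum of `T` vectors of length at most `C`. -/
theorem clipped_sum_sq_le {R T : ℕ} {C : ℝ} {g : ℕ → Fin R → ℝ}
    (hg : ∀ s < T, g s ⬝ᵥ g s ≤ C ^ 2) :
    ∑ r, max ((∑ s ∈ range T, g s) r) 0 ^ 2 ≤ (C * T) ^ 2 := by
  calc ∑ r, max ((∑ s ∈ range T, g s) r) 0 ^ 2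
      ≤ ∑ r, (T : ℝ) * ∑ s ∈ range T, g s r ^ 2 := by
        refine Finset.sum_le_sum fun r _ => ?_
        have h := sq_sum_le_card_mul_sum_sq (s := range T) (f := fun s => g s r)
        rw [Finset.card_range] at h
        rw [Finset.sum_apply]
        refine le_trans ?_ h
        rcases max_cases (∑ s ∈ range T, g s r) 0 with ⟨h, _⟩ | ⟨h, _⟩ <;> rw [h]
        simpa using sq_nonneg _
    _ = T * ∑ s ∈ range T, g s ⬝ᵥ g s := by
        simp_rw [dotProduct_self_eq_sum_sq]
        rw [← Finset.mul_sum, Finset.sum_comm]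
    _ ≤ T * ∑ s ∈ range T, C ^ 2 := by
        gcongr with s hs
        exact hg s (Finset.mem_range.1 hs)
    _ = (C * T) ^ 2 := by simp; ring

theorem sq_integral_le_integral_sq {Ω : Type*} {m0 : MeasurableSpace Ω} {μ : Measure Ω}
    [IsProbabilityMeasure μ] {f : Ω → ℝ} (hf : MemLp f 2 μ) :
    (∫ ω, f ω ∂μ) ^ 2 ≤ ∫ ω, f ω ^ 2 ∂μ := by
  have h := ProbabilityTheory.variance_eq_sub hf
  have h2 := ProbabilityTheory.variance_nonneg f μ
  rw [h] at h2
  simpa using h2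

/-- A bounded predictable vector is orthogonal in mean to a martingale increment. -/
theorem integral_gInner_eq_zero {Ω : Type*} {m m0 : MeasurableSpace Ω} {μ : Measure Ω}
    [IsProbabilityMeasure μ] (hm : m ≤ m0) {N : ℕ} {Dd : Fin N → ℕ}
    {Z ξ : Ω → ((i : Fin N) → Fin (Dd i) → ℝ)} (hZ : StronglyMeasurable[m] Z) {c : ℝ}
    (hZb : ∀ ω, ‖Z ω‖ ≤ c) (hξ : Integrable ξ μ) (hξ0 : μ[ξ|m] =ᵐ[μ] 0) :
    Integrable (fun ω => gInner (Z ω) (ξ ω)) μ ∧ ∫ ω, gInner (Z ω) (ξ ω) ∂μ = 0 := by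
  have key : ∀ i j, Integrable (fun ω => Z ω i j * ξ ω i j) μ ∧
      ∫ ω, Z ω i j * ξ ω i j ∂μ = 0 := fun i j => by
    let L : ((i : Fin N) → Fin (Dd i) → ℝ) →L[ℝ] ℝ :=
      (ContinuousLinearMap.proj j).comp
        (ContinuousLinearMap.proj (R := ℝ) (φ := fun i => Fin (Dd i) → ℝ) i)
    have hZm : StronglyMeasurable[m] (fun ω => Z ω i j) := L.continuous.comp_stronglyMeasurable hZ
    have hξi : Integrable (fun ω => ξ ω i j) μ := L.integrable_comp hξ
    have h_int : Integrable (fun ω => Z ω i j * ξ ω i j) μ :=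
      hξi.bdd_mul (hZm.mono hm).aestronglyMeasurable (Filter.Eventually.of_forall fun ω =>
        ((norm_le_pi_norm _ j).trans (norm_le_pi_norm (Z ω) i)).trans (hZb ω))
    refine ⟨h_int, ?_⟩
    have hcond : μ[fun ω => ξ ω i j|m] =ᵐ[μ] 0 := by
      filter_upwards [L.comp_condExp_comm hξ (m := m), hξ0] with ω h1 h2
      have h3 : μ[fun ω => ξ ω i j|m] ω = L (μ[ξ|m] ω) := h1.symm
      rw [h3, h2]
      simp
    rw [← integral_condExp hm]
    have h := condExp_mul_of_stronglyMeasurable_left hZm h_int hξi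
    have h0 : μ[fun ω => Z ω i j * ξ ω i j|m] =ᵐ[μ] 0 := by
      filter_upwards [h, hcond] with ω h1 h2
      have h3 : μ[fun ω => Z ω i j * ξ ω i j|m] ω = Z ω i j * μ[fun ω => ξ ω i j|m] ω := h1
      rw [h3, h2]
      simp
    rw [integral_congr_ae h0]
    simp
  simp only [gInner, dotProduct]
  refine ⟨integrable_finsetSum _ fun i _ => integrable_finsetSum _ fun j _ => (key i j).1, ?_⟩
  rw [integral_finsetSum _ fun i _ => integrable_finsetSum _ fun j _ => (key i j).1]
  refine Finset.sum_eq_zero fun i _ => ?_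
  rw [integral_finsetSum _ fun j _ => (key i j).1]
  exact Finset.sum_eq_zero fun j _ => (key i j).2

set_option maxHeartbeats 1000000 in
/-- **Constant learning rate: bound on the ANCCVC (bound (10)).**
Run the dynamics with constant parameters γ_τ = γ > 0, η_τ = η ≥ 0, β_τ = 2, ζ_τ = γ on
{0,…,T−1}, Λ_0 = 0, Y_0 = 0, the trackability condition η² − η/4 + γ²C₁²/(4K) ≤ 0, v monotone
on 𝒳, (x*,λ*) a solution of VI(𝒳 × ℝ^R_{≥0}, ṽ), and persistent noise E[‖ξ_τ‖_*²] ≤ σ_*².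
Then, with C̃₁ = 2(C₂²/K + 2C₃²):
(1/T)E[‖[Σ_{τ<T}(AX_τ − b)]₊‖₂] ≤
  √((2(ηT+1)/(γT²))(Δψ/γ + C̃₁γT) + ((ηT+1)²/(γ²T²))‖λ*‖₂² + ((ηT+1)²/T²)(4σ_*²T/K)). -/
theorem stmt17 {Ω : Type*} {m0 : MeasurableSpace Ω} (μ : Measure Ω) [IsProbabilityMeasure μ]
    (𝓕 : Filtration ℕ m0)
    {N R : ℕ} (Dd : Fin N → ℕ)
    -- the agents' action sets 𝒳ᵢ: nonempty, compact, convex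
    (Xset : ∀ i, Set (Fin (Dd i) → ℝ))
    (hXne : ∀ i, (Xset i).Nonempty) (hXcomp : ∀ i, IsCompact (Xset i))
    (hXconv : ∀ i, Convex ℝ (Xset i))
    -- the agents' norms ‖·‖ᵢ
    (nrm : ∀ i, (Fin (Dd i) → ℝ) → ℝ)
    (hnrm0 : ∀ i x, nrm i x = 0 ↔ x = 0)
    (hnrmS : ∀ i (c : ℝ) x, nrm i (c • x) = |c| * nrm i x)
    (hnrmT : ∀ i x y, nrm i (x + y) ≤ nrm i x + nrm i y)
    -- the regularizers ψᵢ: continuous and Kᵢ-strongly convex; K = minᵢ Kᵢ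
    (Ks : Fin N → ℝ) (hKs : ∀ i, 0 < Ks i) (K : ℝ) (hK : IsLeast (Set.range Ks) K)
    (ψ : ∀ i, (Fin (Dd i) → ℝ) → ℝ) (hψcont : ∀ i, ContinuousOn (ψ i) (Xset i))
    (hψsc : ∀ i, ∀ x ∈ Xset i, ∀ y ∈ Xset i, ∀ s ∈ Set.Icc (0 : ℝ) 1,
      ψ i (s • x + (1 - s) • y) ≤ s * ψ i x + (1 - s) * ψ i y
        - Ks i / 2 * s * (1 - s) * nrm i (x - y) ^ 2)
    -- the mirror maps Φᵢ
    (Φ : ∀ i, (Fin (Dd i) → ℝ) → (Fin (Dd i) → ℝ))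
    (hΦmem : ∀ i y, Φ i y ∈ Xset i)
    (hΦmax : ∀ i y, IsMaxOn (fun x => y ⬝ᵥ x - ψ i x) (Xset i) (Φ i y))
    -- the gradient map v, the resource matrix A (as a linear map), its transpose At, capacity b
    (v : ((i : Fin N) → Fin (Dd i) → ℝ) → ((i : Fin N) → Fin (Dd i) → ℝ))
    (A : ((i : Fin N) → Fin (Dd i) → ℝ) →ₗ[ℝ] (Fin R → ℝ))
    (At : (Fin R → ℝ) →ₗ[ℝ] ((i : Fin N) → Fin (Dd i) → ℝ))
    (hadj : ∀ x lam, A x ⬝ᵥ lam = gInner x (At lam))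
    (b : Fin R → ℝ)
    -- the constants C₁, C₂, C₃
    (C₁ C₂ C₃ : ℝ) (hC₁0 : 0 ≤ C₁) (hC₂0 : 0 ≤ C₂) (hC₃0 : 0 ≤ C₃)
    (hC₁ : ∀ lam : Fin R → ℝ, (∀ r, 0 ≤ lam r) →
      gDualN nrm (At lam) ≤ C₁ * Real.sqrt (lam ⬝ᵥ lam))
    (hC₂ : ∀ x, (∀ i, x i ∈ Xset i) → gDualN nrm (v x) ≤ C₂)
    (hC₃ : ∀ x, (∀ i, x i ∈ Xset i) →
      Real.sqrt ((A x - b) ⬝ᵥ (A x - b)) ≤ C₃)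
    -- the step sizes, price progressivity and price sensitivity
    (γ ζ η β : ℕ → ℝ) (hγ : ∀ τ, 0 < γ τ) (hη : ∀ τ, 0 ≤ η τ) (hβ : ∀ τ, 0 ≤ β τ)
    -- the noise: a square-integrable martingale difference sequence
    (ξ : ℕ → Ω → ((i : Fin N) → Fin (Dd i) → ℝ))
    (hξint : ∀ τ : ℕ, Integrable (ξ (τ + 1)) μ)
    (hξsq : ∀ τ : ℕ, Integrable (fun ω => gDualN nrm (ξ (τ + 1) ω) ^ 2) μ)
    (hξmeas : ∀ τ : ℕ, StronglyMeasurable[𝓕 (τ + 1)] (ξ (τ + 1)))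
    (hξcond : ∀ τ : ℕ, μ[ξ (τ + 1)|𝓕 τ] =ᵐ[μ] 0)
    -- the dynamics
    (Y : ℕ → Ω → ((i : Fin N) → Fin (Dd i) → ℝ))
    (Λ : ℕ → Ω → (Fin R → ℝ))
    (X : ℕ → Ω → ((i : Fin N) → Fin (Dd i) → ℝ))
    (hXadapted : ∀ τ, StronglyMeasurable[𝓕 τ] (X τ))
    (hΛadapted : ∀ τ, StronglyMeasurable[𝓕 τ] (Λ τ))
    (hX : ∀ τ ω i, X τ ω i = Φ i (Y τ ω i))
    (hY : ∀ τ ω, Y (τ + 1) ω =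
      Y τ ω + γ τ • (v (X τ ω) + ξ (τ + 1) ω - β τ • At (Λ τ ω)))
    (hΛ : ∀ τ ω r, Λ (τ + 1) ω r =
      max ((1 - η τ) * Λ τ ω r + ζ τ * (A (X τ ω) - b) r) 0)
    -- horizon, constant parameter choices, and the trackability condition
    (T : ℕ) (hT : 0 < T) (γc ηc : ℝ) (hγc : 0 < γc) (hηc : 0 ≤ ηc)
    (hγconst : ∀ τ < T, γ τ = γc) (hηconst : ∀ τ < T, η τ = ηc)
    (hβ2 : ∀ τ < T, β τ = 2) (hζγ : ∀ τ < T, ζ τ = γ τ)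
    (hΛinit : ∀ ω r, Λ 0 ω r = 0) (hYinit : ∀ ω, Y 0 ω = 0)
    (hTC : ηc ^ 2 - ηc / 4 + γc ^ 2 * C₁ ^ 2 / (4 * K) ≤ 0)
    -- persistent noise with power σ_*
    (σs : ℝ) (hσs0 : 0 ≤ σs)
    (hσ : ∀ τ : ℕ, (∫ ω, gDualN nrm (ξ (τ + 1) ω) ^ 2 ∂μ) ≤ σs ^ 2)
    -- v is monotone on 𝒳 and (x*, λ*) solves VI(𝒳 × ℝ^R≥0, ṽ)
    (hmono : ∀ x₁, (∀ i, x₁ i ∈ Xset i) → ∀ x₂, (∀ i, x₂ i ∈ Xset i) →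
      gInner (x₁ - x₂) (v x₁ - v x₂) ≤ 0)
    (xstar : (i : Fin N) → Fin (Dd i) → ℝ) (hxstar : ∀ i, xstar i ∈ Xset i)
    (lamstar : Fin R → ℝ) (hlamstar : ∀ r, 0 ≤ lamstar r)
    (hVI : ∀ x, (∀ i, x i ∈ Xset i) → ∀ lam : Fin R → ℝ, (∀ r, 0 ≤ lam r) →
      gInner (x - xstar) (v xstar - At lamstar)
        + (lam - lamstar) ⬝ᵥ (A xstar - b) ≤ 0) :
    (1 / (T : ℝ)) * ∫ ω, Real.sqrt
        ((fun r => max ((∑ τ ∈ range T, (A (X τ ω) - b)) r) 0) ⬝ᵥ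
          (fun r => max ((∑ τ ∈ range T, (A (X τ ω) - b)) r) 0)) ∂μ ≤
      Real.sqrt
        (2 * (ηc * T + 1) / (γc * (T : ℝ) ^ 2) *
            ((∑ i, (sSup (ψ i '' Xset i) - sInf (ψ i '' Xset i))) / γc
              + 2 * (C₂ ^ 2 / K + 2 * C₃ ^ 2) * γc * T)
          + (ηc * T + 1) ^ 2 / (γc ^ 2 * (T : ℝ) ^ 2) * (lamstar ⬝ᵥ lamstar)
          + (ηc * T + 1) ^ 2 / (T : ℝ) ^ 2 * (4 * σs ^ 2 * T / K)) := by
  have hKpos : 0 < K := by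
    obtain ⟨i, hi⟩ := hK.1
    exact hi ▸ hKs i
  have hKle : ∀ i, K ≤ Ks i := fun i => hK.2 ⟨i, rfl⟩
  have hTpos : (0 : ℝ) < T := Nat.cast_pos.2 hT
  have hXm : ∀ τ ω i, X τ ω i ∈ Xset i := fun τ ω i => hX τ ω i ▸ hΦmem i _
  have hXfun : ∀ τ ω, (fun i => Φ i (Y τ ω i)) = X τ ω := fun τ ω =>
    funext fun i => (hX τ ω i).symm
  have hgsq : ∀ x, (∀ i, x i ∈ Xset i) → (A x - b) ⬝ᵥ (A x - b) ≤ C₃ ^ 2 := fun x hx =>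
    (Real.sqrt_le_left hC₃0).1 (hC₃ x hx)
  -- the regularizers
  set D : ℝ := ∑ i, (sSup (ψ i '' Xset i) - sInf (ψ i '' Xset i)) with hD
  have hDle : ∀ x : (i : Fin N) → Fin (Dd i) → ℝ, (∀ i, x i ∈ Xset i) →
      ∀ z : (i : Fin N) → Fin (Dd i) → ℝ, (∀ i, z i ∈ Xset i) →
      ∑ i, ψ i (x i) - ∑ i, ψ i (z i) ≤ D := fun x hx z hz => by
    rw [← Finset.sum_sub_distrib]
    refine Finset.sum_le_sum fun i _ => ?_
    have hc := (hXcomp i).image_of_continuousOn (hψcont i)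
    exact sub_le_sub (le_csSup hc.bddAbove ⟨_, hx i, rfl⟩) (csInf_le hc.bddBelow ⟨_, hz i, rfl⟩)
  have hD0 : 0 ≤ D := by simpa using hDle xstar hxstar xstar hxstar
  -- consequences of the variational inequality
  have hfeas : ∀ r, (A xstar - b) r ≤ 0 := fun r => by
    have h := hVI xstar hxstar (lamstar + Pi.single r 1) fun k => by
      have : (0 : ℝ) ≤ (Pi.single r (1 : ℝ) : Fin R → ℝ) k := by
        by_cases hk : k = r <;> simp [hk]
      simpa using add_nonneg (hlamstar k) this
    simpa [gInner] using h
  have hcomp : 0 ≤ lamstar ⬝ᵥ (A xstar - b) := by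
    have h := hVI xstar hxstar 0 fun _ => le_rfl
    simpa [gInner] using h
  have hgap : ∀ x, (∀ i, x i ∈ Xset i) →
      gInner (x - xstar) (v x) ≤ lamstar ⬝ᵥ (A x - b) := fun x hx => by
    have h1 := hmono x hx xstar hxstar
    have h2 := hVI x hx lamstar hlamstar
    have h3 := hadj (x - xstar) lamstar
    rw [gInner_sub_right] at h1 h2
    rw [map_sub, dotProduct_comm] at h3
    simp only [sub_self, zero_dotProduct, add_zero, dotProduct_sub] at h2 h3 hcomp ⊢
    linarith
  -- the pathwise energy estimate
  have hΛnn : ∀ τ ω r, 0 ≤ Λ τ ω r := fun τ ω r => by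
    cases τ with
    | zero => exact (hΛinit ω r).ge
    | succ n => rw [hΛ]; exact le_max_right _ _
  have hΛstep : ∀ ω, ∀ n < T, ∀ r, Λ (n + 1) ω r =
      max (Λ n ω r + (γc * (A (X n ω) - b) r - ηc * Λ n ω r)) 0 := fun ω n hn r => by
    rw [hΛ, hηconst n hn, hζγ n hn, hγconst n hn]
    congr 1
    ring
  let U : Ω → ℝ := fun ω => ∑ r, max ((∑ τ ∈ range T, (A (X τ ω) - b)) r) 0 ^ 2
  have hU0 : ∀ ω, 0 ≤ U ω := fun ω => Finset.sum_nonneg fun _ _ => sq_nonneg _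
  have hUle : ∀ ω, U ω ≤ (C₃ * T) ^ 2 := fun ω =>
    clipped_sum_sq_le fun s _ => hgsq _ (hXm s ω)
  have hUeq : ∀ ω, (fun r => max ((∑ τ ∈ range T, (A (X τ ω) - b)) r) 0) ⬝ᵥ
      (fun r => max ((∑ τ ∈ range T, (A (X τ ω) - b)) r) 0) = U ω := fun ω =>
    dotProduct_self_eq_sum_sq _
  simp_rw [hUeq]
  have hUmeas : Measurable U := by
    have hg : ∀ τ, Measurable fun ω => A (X τ ω) - b := fun τ =>
      ((LinearMap.continuous_of_finiteDimensional A).measurable.comp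
        ((hXadapted τ).mono (𝓕.le τ)).measurable).sub_const b
    refine Finset.measurable_sum _ fun r _ => ?_
    refine Measurable.pow_const (Measurable.max ?_ measurable_const) 2
    exact (measurable_pi_apply r).comp (Finset.measurable_fun_sum _ fun τ _ => hg τ)
  have hsqrt_le : ∀ ω, Real.sqrt (U ω) ≤ C₃ * T := fun ω =>
    Real.sqrt_le_iff.2 ⟨by positivity, hUle ω⟩
  have hL2 : MemLp (fun ω => Real.sqrt (U ω)) 2 μ := by
    refine MemLp.of_bound hUmeas.sqrt.aestronglyMeasurable (C₃ * T)
      (Filter.Eventually.of_forall fun ω => ?_)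
    rw [Real.norm_of_nonneg (Real.sqrt_nonneg _)]
    exact hsqrt_le ω
  have hUint : Integrable U μ := by
    refine Integrable.of_bound hUmeas.aestronglyMeasurable ((C₃ * T) ^ 2)
      (Filter.Eventually.of_forall fun ω => ?_)
    rw [Real.norm_of_nonneg (hU0 ω)]
    exact hUle ω
  have hlam0 : 0 ≤ lamstar ⬝ᵥ lamstar := by
    rw [dotProduct_self_eq_sum_sq]
    exact Finset.sum_nonneg fun _ _ => sq_nonneg _
  have hp : 0 < ηc * T + 1 := by positivity
  suffices hsuff : ∫ ω, U ω ∂μ ≤ 2 * (ηc * T + 1) / γc *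
        (D / γc + 2 * (C₂ ^ 2 / K + 2 * C₃ ^ 2) * γc * T)
      + (ηc * T + 1) ^ 2 / γc ^ 2 * (lamstar ⬝ᵥ lamstar)
      + (ηc * T + 1) ^ 2 * (4 * σs ^ 2 * T / K) by
    refine Real.le_sqrt_of_sq_le ?_
    have h1 := sq_integral_le_integral_sq hL2
    simp_rw [Real.sq_sqrt (hU0 _)] at h1
    have h2 := mul_le_mul_of_nonneg_left (h1.trans hsuff) (by positivity : 0 ≤ (1 / (T : ℝ)) ^ 2)
    rw [mul_pow]
    refine h2.trans (le_of_eq ?_)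
    field_simp
  rcases le_or_gt ηc (1 / 6) with hη6 | hη6
  swap
  · have h1 : ∫ ω, U ω ∂μ ≤ (C₃ * T) ^ 2 := by
      have := integral_mono hUint (integrable_const _) hUle
      simpa using this
    have h2 : (C₃ * T) ^ 2 ≤ 2 * (ηc * T + 1) / γc * (2 * (2 * C₃ ^ 2) * γc * T) := by
      have h3 : 2 * (ηc * T + 1) / γc * (2 * (2 * C₃ ^ 2) * γc * T)
          = 8 * (ηc * T + 1) * T * C₃ ^ 2 := by
        field_simp
        ring
      rw [h3, mul_pow, mul_comm]
      refine mul_le_mul_of_nonneg_right ?_ (sq_nonneg _)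
      nlinarith
    have h4 : 2 * (ηc * T + 1) / γc * (2 * (2 * C₃ ^ 2) * γc * T) ≤
        2 * (ηc * T + 1) / γc * (D / γc + 2 * (C₂ ^ 2 / K + 2 * C₃ ^ 2) * γc * T) := by
      refine mul_le_mul_of_nonneg_left ?_ (by positivity)
      have : 0 ≤ D / γc + 2 * (C₂ ^ 2 / K) * γc * T := by positivity
      linarith
    have h5 : 0 ≤ (ηc * T + 1) ^ 2 / γc ^ 2 * (lamstar ⬝ᵥ lamstar) := by positivity
    have h6 : 0 ≤ (ηc * T + 1) ^ 2 * (4 * σs ^ 2 * T / K) := by positivity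
    linarith
  have hpath : ∀ ω, U ω ≤ 2 * (ηc * T + 1) / γc ^ 2 *
      (D + ∑ s ∈ range T, (γc * gInner (X s ω - xstar) (ξ (s + 1) ω)
        + γc ^ 2 / K * (C₂ ^ 2 + gDualN nrm (ξ (s + 1) ω) ^ 2) + 4 * γc ^ 2 * C₃ ^ 2))
      + (ηc * T + 1) ^ 2 / γc ^ 2 * (lamstar ⬝ᵥ lamstar) := fun ω => by
    let e : ℕ → ℝ := fun s => γc * (lamstar ⬝ᵥ (A (X s ω) - b))
      + (γc * gInner (X s ω - xstar) (ξ (s + 1) ω)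
        + γc ^ 2 / K * (C₂ ^ 2 + gDualN nrm (ξ (s + 1) ω) ^ 2))
    let Z : ℕ → (i : Fin N) → Fin (Dd i) → ℝ := fun s =>
      Y s ω + γc • (v (X s ω) + ξ (s + 1) ω)
    let G : ((i : Fin N) → Fin (Dd i) → ℝ) → ℝ := fun y => conjugateSum ψ Φ y - gInner xstar y
    have hhalf : ∀ s, G (Z s) ≤ G (Y s ω) + e s := fun s => by
      have h1 := conjugateSum_smooth hXconv hnrm0 hnrmS hnrmT hKpos hKle hψsc hΦmem hΦmax hγc.le
        (Y s ω) (v (X s ω)) (ξ (s + 1) ω)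
      rw [hXfun] at h1
      have h2 := mul_le_mul_of_nonneg_left (hgap _ (hXm s ω)) hγc.le
      have h3 : γc ^ 2 / K * (gDualN nrm (v (X s ω)) ^ 2 + gDualN nrm (ξ (s + 1) ω) ^ 2) ≤
          γc ^ 2 / K * (C₂ ^ 2 + gDualN nrm (ξ (s + 1) ω) ^ 2) := by
        gcongr
        · exact Real.sqrt_nonneg _
        · exact hC₂ _ (hXm s ω)
      simp only [G, Z, e, gInner_add_right, gInner_smul_right, gInner_sub_left] at *
      linarith
    have hfull : ∀ n, n + 1 < T →
        G (Y (n + 1) ω) ≤ G (Z n) - 2 * γc * ((A (X (n + 1) ω) - b) ⬝ᵥ Λ n ω) := fun n hn => by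
      have hYZ : Y (n + 1) ω = Z n + (-(2 * γc)) • At (Λ n ω) := by
        rw [hY, hγconst n (by omega), hβ2 n (by omega)]
        simp only [Z, smul_sub, neg_smul, smul_smul, mul_comm γc 2]
        abel
      have h1 := conjugateSum_add_le hΦmem hΦmax (Z n) ((-(2 * γc)) • At (Λ n ω))
      rw [← hYZ, hXfun, gInner_smul_right, ← hadj] at h1
      have h2 : (A xstar - b) ⬝ᵥ Λ n ω ≤ 0 :=
        Finset.sum_nonpos fun r _ => mul_nonpos_of_nonpos_of_nonneg (hfeas r) (hΛnn n ω r)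
      have h3 := mul_le_mul_of_nonneg_left h2 (by positivity : 0 ≤ 2 * γc)
      have h4 : gInner xstar (Y (n + 1) ω) =
          gInner xstar (Z n) - 2 * γc * (A xstar ⬝ᵥ Λ n ω) := by
        rw [hYZ, gInner_add_right, gInner_smul_right, ← hadj]
        ring
      simp only [sub_dotProduct] at h3 ⊢
      simp only [G, h4]
      linarith
    obtain ⟨m, rfl⟩ : ∃ m, T = m + 1 := ⟨T - 1, by omega⟩
    have henergy := price_energy_le (H := fun s => G (Z s)) (e := e) (H₀ := G 0)
      (l := fun s => Λ s ω) (g := fun s => A (X s ω) - b) hηc hη6 (hΛinit ω) (hΛstep ω)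
      (by simpa [hYinit] using hhalf 0)
      (fun n hn => by
        have := hhalf (n + 1)
        have := hfull n hn
        linarith) m (Nat.lt_succ_self m)
    have hclip := clipped_violation_sq_le (l := fun s => Λ s ω) (g := fun s => A (X s ω) - b)
      hγc.le hηc (hΛinit ω) (hΛstep ω)
    have hGlow : -∑ i, ψ i (xstar i) ≤ G (Z m) := by
      have := gInner_sub_le_conjugateSum hΦmax hxstar (Z m)
      simp only [G]
      linarith
    have hG0 : G 0 + ∑ i, ψ i (xstar i) ≤ D := by
      have := hDle xstar hxstar (fun i => Φ i 0) (fun i => hΦmem i 0)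
      simp only [G, conjugateSum, gInner, Pi.zero_apply, zero_dotProduct, dotProduct_zero,
        Finset.sum_const_zero, zero_sub, Finset.sum_neg_distrib, sub_zero]
      linarith
    have hq : 0 ≤ ∑ r, (γc * (A (X m ω) - b) r - ηc * Λ m ω r) ^ 2 :=
      Finset.sum_nonneg fun _ _ => sq_nonneg _
    have hsum : ∑ s ∈ range (m + 1), (e s + 4 * γc ^ 2 * ((A (X s ω) - b) ⬝ᵥ (A (X s ω) - b))) ≤
        γc * (lamstar ⬝ᵥ ∑ s ∈ range (m + 1), (A (X s ω) - b))
        + ∑ s ∈ range (m + 1), (γc * gInner (X s ω - xstar) (ξ (s + 1) ω)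
        + γc ^ 2 / K * (C₂ ^ 2 + gDualN nrm (ξ (s + 1) ω) ^ 2) + 4 * γc ^ 2 * C₃ ^ 2) := by
      rw [dotProduct_sum, Finset.mul_sum, ← Finset.sum_add_distrib]
      refine Finset.sum_le_sum fun s _ => ?_
      have := mul_le_mul_of_nonneg_left (hgsq _ (hXm s ω)) (by positivity : 0 ≤ 4 * γc ^ 2)
      simp only [e]
      linarith
    set B : ℝ := ∑ s ∈ range (m + 1), (γc * gInner (X s ω - xstar) (ξ (s + 1) ω)
        + γc ^ 2 / K * (C₂ ^ 2 + gDualN nrm (ξ (s + 1) ω) ^ 2) + 4 * γc ^ 2 * C₃ ^ 2)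
    set p : ℝ := ηc * ((m + 1 : ℕ) : ℝ) + 1 with hpdef
    have hyoung : 2 * p * γc * (lamstar ⬝ᵥ ∑ s ∈ range (m + 1), (A (X s ω) - b)) ≤
        γc ^ 2 * U ω + p ^ 2 * (lamstar ⬝ᵥ lamstar) := by
      rw [dotProduct_self_eq_sum_sq, dotProduct, Finset.mul_sum, Finset.mul_sum, Finset.mul_sum,
        ← Finset.sum_add_distrib]
      refine Finset.sum_le_sum fun r _ => ?_
      have h1 := mul_le_mul_of_nonneg_left
        (le_max_left ((∑ s ∈ range (m + 1), (A (X s ω) - b)) r) 0)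
        (mul_nonneg (mul_nonneg hp.le hγc.le) (hlamstar r))
      nlinarith [sq_nonneg (γc * max ((∑ s ∈ range (m + 1), (A (X s ω) - b)) r) 0
        - p * lamstar r)]
    have hP : Λ (m + 1) ω ⬝ᵥ Λ (m + 1) ω + ηc * ∑ s ∈ range (m + 1), Λ s ω ⬝ᵥ Λ s ω ≤
        D + B + γc * (lamstar ⬝ᵥ ∑ s ∈ range (m + 1), (A (X s ω) - b)) := by
      linarith
    have hmain : γc ^ 2 * U ω ≤ 2 * p * (D + B) + p ^ 2 * (lamstar ⬝ᵥ lamstar) := by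
      have h1 := hclip.trans (mul_le_mul_of_nonneg_left hP hp.le)
      have h2 : γc ^ 2 * U ω ≤
          p * (D + B + γc * (lamstar ⬝ᵥ ∑ s ∈ range (m + 1), (A (X s ω) - b))) := h1
      linarith
    calc U ω = γc ^ 2 * U ω / γc ^ 2 := by field_simp
      _ ≤ (2 * p * (D + B) + p ^ 2 * (lamstar ⬝ᵥ lamstar)) / γc ^ 2 := by gcongr
      _ = _ := by ring
  -- taking expectations
  have hbound : ∃ c, ∀ s ω, ‖X s ω - xstar‖ ≤ c := by
    obtain ⟨c, hc⟩ := (isCompact_univ_pi hXcomp).isBounded.exists_norm_le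
    refine ⟨c + c, fun s ω => (norm_sub_le _ _).trans (add_le_add (hc _ ?_) (hc _ ?_))⟩
    · exact fun i _ => hXm s ω i
    · exact fun i _ => hxstar i
  obtain ⟨c, hc⟩ := hbound
  have hmart := fun s => integral_gInner_eq_zero (𝓕.le s)
    ((hXadapted s).sub stronglyMeasurable_const) (fun ω => hc s ω) (hξint s) (hξcond s)
  have hterm : ∀ s, Integrable (fun ω => γc * gInner (X s ω - xstar) (ξ (s + 1) ω)
        + γc ^ 2 / K * (C₂ ^ 2 + gDualN nrm (ξ (s + 1) ω) ^ 2) + 4 * γc ^ 2 * C₃ ^ 2) μ ∧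
      ∫ ω, (γc * gInner (X s ω - xstar) (ξ (s + 1) ω)
        + γc ^ 2 / K * (C₂ ^ 2 + gDualN nrm (ξ (s + 1) ω) ^ 2) + 4 * γc ^ 2 * C₃ ^ 2) ∂μ
      ≤ γc ^ 2 / K * (C₂ ^ 2 + σs ^ 2) + 4 * γc ^ 2 * C₃ ^ 2 := fun s => by
    have i1 : Integrable (fun ω => γc * gInner (X s ω - xstar) (ξ (s + 1) ω)) μ :=
      (hmart s).1.const_mul γc
    have i2 : Integrable (fun ω => C₂ ^ 2 + gDualN nrm (ξ (s + 1) ω) ^ 2) μ :=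
      (integrable_const _).add (hξsq s)
    have i3 := i2.const_mul (γc ^ 2 / K)
    have i4 : Integrable (fun ω => γc * gInner (X s ω - xstar) (ξ (s + 1) ω)
        + γc ^ 2 / K * (C₂ ^ 2 + gDualN nrm (ξ (s + 1) ω) ^ 2)) μ := i1.add i3
    refine ⟨i4.add (integrable_const _), ?_⟩
    rw [integral_add i4 (integrable_const _), integral_add i1 i3, integral_const_mul,
      integral_const_mul, integral_add (integrable_const _) (hξsq s)]
    have h0 : ∫ ω, gInner (X s ω - xstar) (ξ (s + 1) ω) ∂μ = 0 := (hmart s).2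
    rw [h0]
    simp only [integral_const, probReal_univ, one_smul, mul_zero, zero_add]
    gcongr
    exact hσ s
  have hB : ∫ ω, ∑ s ∈ range T, (γc * gInner (X s ω - xstar) (ξ (s + 1) ω)
        + γc ^ 2 / K * (C₂ ^ 2 + gDualN nrm (ξ (s + 1) ω) ^ 2) + 4 * γc ^ 2 * C₃ ^ 2) ∂μ
      ≤ T * (γc ^ 2 / K * (C₂ ^ 2 + σs ^ 2) + 4 * γc ^ 2 * C₃ ^ 2) := by
    rw [integral_finsetSum _ fun s _ => (hterm s).1]
    refine (Finset.sum_le_sum fun s _ => (hterm s).2).trans_eq ?_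
    rw [Finset.sum_const, Finset.card_range, nsmul_eq_mul]
  let B : Ω → ℝ := fun ω => ∑ s ∈ range T, (γc * gInner (X s ω - xstar) (ξ (s + 1) ω)
        + γc ^ 2 / K * (C₂ ^ 2 + gDualN nrm (ξ (s + 1) ω) ^ 2) + 4 * γc ^ 2 * C₃ ^ 2)
  have hBint : Integrable B μ := integrable_finsetSum (range T) fun s _ => (hterm s).1
  have hDBint : Integrable (fun ω => 2 * (ηc * T + 1) / γc ^ 2 * (D + B ω)) μ :=
    ((integrable_const D).add hBint).const_mul _
  have hexp : ∫ ω, U ω ∂μ ≤ ∫ ω, (2 * (ηc * T + 1) / γc ^ 2 * (D + B ω)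
      + (ηc * T + 1) ^ 2 / γc ^ 2 * (lamstar ⬝ᵥ lamstar)) ∂μ :=
    integral_mono hUint (hDBint.add (integrable_const _)) hpath
  rw [integral_add hDBint (integrable_const _), integral_const_mul,
    integral_add (integrable_const _) hBint] at hexp
  simp only [integral_const, probReal_univ, one_smul] at hexp
  refine hexp.trans ?_
  have h1 := mul_le_mul_of_nonneg_left (add_le_add_right hB D)
    (by positivity : 0 ≤ 2 * (ηc * T + 1) / γc ^ 2)
  have h2 : 2 * (ηc * T + 1) / γc ^ 2 *
        (D + T * (γc ^ 2 / K * (C₂ ^ 2 + σs ^ 2) + 4 * γc ^ 2 * C₃ ^ 2))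
      = 2 * (ηc * T + 1) / γc * (D / γc + (C₂ ^ 2 / K + 4 * C₃ ^ 2) * γc * T)
        + 2 * (ηc * T + 1) * (σs ^ 2 * T / K) := by
    field_simp
    ring
  have h3 : 2 * (ηc * T + 1) / γc * (D / γc + (C₂ ^ 2 / K + 4 * C₃ ^ 2) * γc * T) ≤
      2 * (ηc * T + 1) / γc * (D / γc + 2 * (C₂ ^ 2 / K + 2 * C₃ ^ 2) * γc * T) := by
    refine mul_le_mul_of_nonneg_left ?_ (by positivity)
    have : 0 ≤ C₂ ^ 2 / K * γc * T := by positivity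
    linarith
  have h4 : 2 * (ηc * T + 1) * (σs ^ 2 * T / K) ≤ (ηc * T + 1) ^ 2 * (4 * σs ^ 2 * T / K) := by
    have h5 : 2 * (ηc * T + 1) ≤ 4 * (ηc * T + 1) ^ 2 := by nlinarith [mul_nonneg hηc hTpos.le]
    have h6 := mul_le_mul_of_nonneg_right h5 (by positivity : 0 ≤ σs ^ 2 * T / K)
    refine h6.trans_eq ?_
    ring
  linarith
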